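/- Let G be a finite additive group, and let p_D, p_Z : G → ℝ be probability mass functions on G (nonnegative, each summing to 1), with p_D(d) > 0 for every d. Let X = D + Z where D and Z are independent with distributions p_D and p_Z, so that the distribution of X is the convolution p_X(x) = Σ_{d∈G} p_D(d) · p_Z(x − d). Then the Rényi order-2 entropy of X is at least that of Z: −log₂ ( Σ_{x∈G} p_X(x)² ) ≥ −log₂ ( Σ_{z∈G} p_Z(z)² ). -/

import Mathlib

open Real

theorem renyi_entropy_sum_ge_noise
    {G : Type*} [AddGroup G] [Fintype G]
    (pD pZ : G → ℝ)
    (hD0 : ∀ d, 0 ≤ pD d) (hZ0 : ∀ z, 0 ≤ pZ z)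
    (hD1 : ∑ d : G, pD d = 1) (hZ1 : ∑ z : G, pZ z = 1)
    (hDpos : ∀ d, 0 < pD d)
    (pX : G → ℝ) (hpX : ∀ x, pX x = ∑ d : G, pD d * pZ (x - d)) :
    - Real.logb 2 (∑ x : G, pX x ^ 2) ≥ - Real.logb 2 (∑ z : G, pZ z ^ 2) := by
  have shift : ∀ (f : G → ℝ) (d : G), ∑ x : G, f (x - d) = ∑ x : G, f x := fun f d =>
    Equiv.sum_comp (Equiv.subRight d) f
  have hX1 : ∑ x : G, pX x = 1 := by
    simp only [hpX]
    rw [Finset.sum_comm]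
    simp only [← Finset.mul_sum, shift, hZ1, mul_one, hD1]
  have hpos : 0 < ∑ x : G, pX x ^ 2 := by
    have hne : ∃ x, pX x ≠ 0 := by
      by_contra! h
      simp [h] at hX1
    obtain ⟨x, hx⟩ := hne
    exact Finset.sum_pos' (fun i _ => sq_nonneg _) ⟨x, Finset.mem_univ _, by positivity⟩
  have hle : ∑ x : G, pX x ^ 2 ≤ ∑ z : G, pZ z ^ 2 := by
    calc ∑ x : G, pX x ^ 2 ≤ ∑ x : G, ∑ d : G, pD d * pZ (x - d) ^ 2 := by
          refine Finset.sum_le_sum fun x _ => ?_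
          rw [hpX]
          exact Real.pow_arith_mean_le_arith_mean_pow _ _ _ (fun d _ => hD0 d) hD1 (fun d _ => hZ0 _) 2
      _ = ∑ z : G, pZ z ^ 2 := by
          rw [Finset.sum_comm]
          simp only [← Finset.mul_sum, shift (fun z => pZ z ^ 2)]
          rw [← Finset.sum_mul, hD1, one_mul]
  exact neg_le_neg (Real.logb_le_logb_of_le (by norm_num) hpos hle)
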